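/- Suppose (g_1,…,g_{n-1}) is strongly monotone on B. Then S intersects the boundary of B in at most two points: the set S ∩ ∂B has at most two elements. -/

import Mathlib

/-- The partial derivative `∂f/∂x_i` at `p`. -/
noncomputable def pd {m : ℕ} (f : (Fin m → ℝ) → ℝ) (i : Fin m) (p : Fin m → ℝ) : ℝ :=
  fderiv ℝ f p (Pi.single i 1)

/-- `f` is continuously differentiable on an open set containing `B`. -/
def C1On {m : ℕ} (f : (Fin m → ℝ) → ℝ) (B : Set (Fin m → ℝ)) : Prop :=
  ∃ U : Set (Fin m → ℝ), IsOpen U ∧ B ⊆ U ∧ ContDiffOn ℝ 1 f U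

/-- `M` is an admissible `i`-minor of the family `g = (g_1, …, g_{n+1})` of
functions on `ℝ^{n+2}` over `B`: there are points `q j ∈ B` with
`M j k = (∂ g_j / ∂ x_{c k})(q j)`, where `c = i.succAbove` is the increasing
enumeration of the complement of `{i}` in `Fin (n+2)`. -/
def AdmMinor (n : ℕ) (g : Fin (n+1) → (Fin (n+2) → ℝ) → ℝ) (B : Set (Fin (n+2) → ℝ))
    (i : Fin (n+2)) (M : Matrix (Fin (n+1)) (Fin (n+1)) ℝ) : Prop :=
  ∃ q : Fin (n+1) → (Fin (n+2) → ℝ), (∀ j, q j ∈ B) ∧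
    ∀ j k, M j k = pd (g j) (i.succAbove k) (q j)

/-- The family `(g_1, …, g_{n+1})` is strongly monotone on `B`: every admissible
`i`-minor over `B` has nonzero determinant, for every `i`. -/
def StrongMono (n : ℕ) (g : Fin (n+1) → (Fin (n+2) → ℝ) → ℝ)
    (B : Set (Fin (n+2) → ℝ)) : Prop :=
  ∀ (i : Fin (n+2)) (M : Matrix (Fin (n+1)) (Fin (n+1)) ℝ), AdmMinor n g B i M → M.det ≠ 0

/-- The mean value theorem on a convex set, with the increment expressed through partial derivatives. -/
theorem C1On.exists_sub_eq_sum_pd {m : ℕ} {f : (Fin m → ℝ) → ℝ} {B : Set (Fin m → ℝ)}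
    (hf : C1On f B) (hB : Convex ℝ B) {x y : Fin m → ℝ} (hx : x ∈ B) (hy : y ∈ B) :
    ∃ z ∈ B, f y - f x = ∑ k, pd f k z * (y k - x k) := by
  obtain ⟨U, hU, hBU, hfU⟩ := hf
  obtain ⟨z, hz, h⟩ := domain_mvt (f := f) (f' := fderiv ℝ f)
    (fun w hw => ((hfU.differentiableOn one_ne_zero).differentiableAt
      (hU.mem_nhds (hBU hw))).hasFDerivAt.hasFDerivWithinAt) hB hx hy
  refine ⟨z, hB.segment_subset hx hy hz, ?_⟩
  calc f y - f x = (fderiv ℝ f z : (Fin m → ℝ) →ₗ[ℝ] ℝ) (y - x) := h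
    _ = ∑ k, pd f k z * (y k - x k) := by
      rw [LinearMap.pi_apply_eq_sum_univ]
      refine Finset.sum_congr rfl fun k _ => ?_
      rw [smul_eq_mul, mul_comm, pd, Pi.sub_apply, ContinuousLinearMap.coe_coe]
      congr 2
      ext l
      simp [Pi.single_apply, eq_comm]

theorem C1On.continuousOn_pd {m : ℕ} {f : (Fin m → ℝ) → ℝ} {B : Set (Fin m → ℝ)}
    (hf : C1On f B) (k : Fin m) : ContinuousOn (pd f k) B := by
  obtain ⟨U, hU, hBU, hfU⟩ := hf
  exact ((hfU.continuousOn_fderiv_of_isOpen hU le_rfl).mono hBU).clm_apply continuousOn_const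

/-- The `(N + 1) × (N + 1)` matrix whose zeroth row is the `i`-th standard basis vector and whose remaining
rows are those of `R`. Its determinant is the signed minor of `R` with column `i` deleted. -/
def borderedMatrix {N : ℕ} (R : Fin N → Fin (N + 1) → ℝ) (i : Fin (N + 1)) :
    Matrix (Fin (N + 1)) (Fin (N + 1)) ℝ :=
  Matrix.of (Fin.cons (Pi.single i 1) R)

theorem det_borderedMatrix {N : ℕ} (R : Fin N → Fin (N + 1) → ℝ) (i : Fin (N + 1)) :
    (borderedMatrix R i).det =
      (-1) ^ (i : ℕ) * (Matrix.of fun j k => R j (i.succAbove k)).det := by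
  rw [Matrix.det_succ_row_zero, Finset.sum_eq_single i]
  · simp only [borderedMatrix, Matrix.of_apply, Fin.cons_zero, Pi.single_eq_same, mul_one]
    rfl
  · intro k _ hk
    simp [borderedMatrix, hk]
  · simp

/-- A vector annihilated by all rows of `R` is proportional to the vector of signed minors. -/
theorem det_borderedMatrix_mul_comm {N : ℕ} {R : Fin N → Fin (N + 1) → ℝ} {v : Fin (N + 1) → ℝ}
    (hv : ∀ j, ∑ k, R j k * v k = 0) (i k : Fin (N + 1)) :
    (borderedMatrix R i).det * v k = v i * (borderedMatrix R k).det := by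
  have hAv : (borderedMatrix R i).mulVec v = Pi.single 0 (v i) := by
    ext j
    refine Fin.cases ?_ (fun j => ?_) j
    · simp [Matrix.mulVec, dotProduct, borderedMatrix, Pi.single_apply]
    · simpa [Matrix.mulVec, dotProduct, borderedMatrix] using hv j
  have h := congrFun (congrArg (borderedMatrix R i).adjugate.mulVec hAv) k
  rw [Matrix.mulVec_mulVec, Matrix.adjugate_mul, Matrix.smul_mulVec, Matrix.one_mulVec,
    Matrix.mulVec_single] at h
  have hrow : (borderedMatrix R i).updateRow 0 (Pi.single k 1) = borderedMatrix R k := by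
    ext j l
    refine Fin.cases ?_ (fun j => ?_) j <;> simp [borderedMatrix, Matrix.updateRow_apply]
  simpa [Matrix.adjugate_apply, hrow, mul_comm] using h

theorem StrongMono.det_borderedMatrix_ne_zero {n : ℕ} {g : Fin (n + 1) → (Fin (n + 2) → ℝ) → ℝ}
    {B : Set (Fin (n + 2) → ℝ)} (hg : StrongMono n g B) (i : Fin (n + 2))
    {q : Fin (n + 1) → Fin (n + 2) → ℝ} (hq : ∀ j, q j ∈ B) :
    (borderedMatrix (fun j k => pd (g j) k (q j)) i).det ≠ 0 := by
  rw [det_borderedMatrix]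
  exact mul_ne_zero (pow_ne_zero _ (by norm_num)) (hg i _ ⟨q, hq, fun _ _ => rfl⟩)

/-- The signed minors of a strongly monotone family have constant sign. -/
theorem StrongMono.det_borderedMatrix_mul_pos {n : ℕ}
    {g : Fin (n + 1) → (Fin (n + 2) → ℝ) → ℝ} {B : Set (Fin (n + 2) → ℝ)}
    (hg : StrongMono n g B) (hB : Convex ℝ B) (hC1 : ∀ j, C1On (g j) B) (i : Fin (n + 2))
    {q q' : Fin (n + 1) → Fin (n + 2) → ℝ} (hq : ∀ j, q j ∈ B) (hq' : ∀ j, q' j ∈ B) :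
    0 < (borderedMatrix (fun j k => pd (g j) k (q j)) i).det *
      (borderedMatrix (fun j k => pd (g j) k (q' j)) i).det := by
  set D : (Fin (n + 1) → Fin (n + 2) → ℝ) → ℝ :=
    fun q => (borderedMatrix (fun j k => pd (g j) k (q j)) i).det
  set P : Set (Fin (n + 1) → Fin (n + 2) → ℝ) := Set.univ.pi fun _ => B
  have hP : IsPreconnected P := (convex_pi fun _ _ => hB).isPreconnected
  have hD : ContinuousOn D P := by
    rw [continuousOn_iff_continuous_domRestrict]
    refine Continuous.matrix_det (continuous_matrix fun j k => ?_)
    refine Fin.cases ?_ (fun j => ?_) j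
    · exact continuous_const
    · exact ((hC1 j).continuousOn_pd k).comp_continuous
        ((continuous_apply j).comp continuous_subtype_val) fun q => q.2 j (Set.mem_univ j)
  have hne : ∀ q ∈ P, D q ≠ 0 := fun q hq =>
    hg.det_borderedMatrix_ne_zero i fun j => hq j (Set.mem_univ j)
  have hqP : q ∈ P := fun j _ => hq j
  have hqP' : q' ∈ P := fun j _ => hq' j
  rcases (hne q hqP).lt_or_gt with h | h <;> rcases (hne q' hqP').lt_or_gt with h' | h'
  · exact mul_pos_of_neg_of_neg h h'
  · obtain ⟨z, hz, h0⟩ := hP.intermediate_value hqP hqP' hD ⟨h.le, h'.le⟩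
    exact absurd h0 (hne z hz)
  · obtain ⟨z, hz, h0⟩ := hP.intermediate_value hqP' hqP hD ⟨h'.le, h.le⟩
    exact absurd h0 (hne z hz)
  · exact mul_pos h h'

/-- The common zeros of a strongly monotone family form a chain for a strict coordinatewise
order whose coordinate directions are given by a sign vector `D`. -/
theorem StrongMono.exists_chain {n : ℕ} {g : Fin (n + 1) → (Fin (n + 2) → ℝ) → ℝ}
    {B : Set (Fin (n + 2) → ℝ)} (hg : StrongMono n g B) (hB : Convex ℝ B)
    (hC1 : ∀ j, C1On (g j) B) :
    ∃ D : Fin (n + 2) → ℝ, ∀ x ∈ B, ∀ y ∈ B, (∀ j, g j x = 0) → (∀ j, g j y = 0) → x ≠ y →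
      (∀ i, D i * x i < D i * y i) ∨ (∀ i, D i * y i < D i * x i) := by
  rcases B.eq_empty_or_nonempty with rfl | ⟨p, hp⟩
  · exact ⟨0, fun x hx => absurd hx (Set.notMem_empty x)⟩
  refine ⟨fun i => (borderedMatrix (fun j k => pd (g j) k p) i).det, fun x hx y hy hgx hgy hxy => ?_⟩
  choose q hqB hq using fun j => (hC1 j).exists_sub_eq_sum_pd hB hx hy
  have hker : ∀ j, ∑ k, pd (g j) k (q j) * (y - x) k = 0 := fun j => by
    simpa [hgx, hgy] using (hq j).symm
  have hprop := det_borderedMatrix_mul_comm hker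
  have hsign := fun i => hg.det_borderedMatrix_mul_pos hB hC1 i (fun _ => hp) hqB
  obtain ⟨l, hl⟩ := Function.ne_iff.mp hxy
  set E := fun i => (borderedMatrix (fun j k => pd (g j) k (q j)) i).det
  set D := fun i => (borderedMatrix (fun j k => pd (g j) k p) i).det
  have hEl : E l ≠ 0 := hg.det_borderedMatrix_ne_zero l hqB
  have hDE : ∀ i, D i * (y i - x i) = (D i * E i) * ((y l - x l) / E l) := fun i => by
    have : E l * (y i - x i) = (y l - x l) * E i := hprop l i
    field_simp
    linear_combination D i * this
  have hc : (y l - x l) / E l ≠ 0 := div_ne_zero (sub_ne_zero.mpr hl.symm) hEl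
  rcases hc.lt_or_gt with h | h
  · refine Or.inr fun i => ?_
    have := hDE i ▸ mul_neg_of_pos_of_neg (hsign i) h
    linarith
  · refine Or.inl fun i => ?_
    have := hDE i ▸ mul_pos (hsign i) h
    linarith

/-- A point of a box lying strictly between two others in every coordinate direction `D` is not
on the boundary. -/
theorem notMem_frontier_Icc_of_between {ι : Type*} [Finite ι] {a b x y z D : ι → ℝ}
    (hx : x ∈ Set.Icc a b) (hz : z ∈ Set.Icc a b)
    (hxy : ∀ i, D i * x i < D i * y i) (hyz : ∀ i, D i * y i < D i * z i) :
    y ∉ frontier (Set.Icc a b) := by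
  refine fun hy => hy.2 ?_
  rw [← Set.pi_univ_Icc, interior_pi_set Set.finite_univ]
  intro i _
  simp only [interior_Icc]
  have hxi := hx.1 i
  have hxi' := hx.2 i
  have hzi := hz.1 i
  have hzi' := hz.2 i
  rcases le_total (D i) 0 with h | h
  · have h1 := lt_of_mul_lt_mul_of_nonpos_left (hxy i) h
    have h2 := lt_of_mul_lt_mul_of_nonpos_left (hyz i) h
    exact ⟨hzi.trans_lt h2, h1.trans_le hxi'⟩
  · have h1 := lt_of_mul_lt_mul_left (hxy i) h
    have h2 := lt_of_mul_lt_mul_left (hyz i) h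
    exact ⟨hxi.trans_lt h1, h2.trans_le hzi'⟩

/-- If `(g_1,…,g_{n-1})` is strongly monotone on `B`, then `S` meets the
topological boundary of `B` in at most two points. -/
theorem boundary_inter_at_most_two (n : ℕ) (a b : Fin (n+2) → ℝ)
    (hab : ∀ i, a i < b i) (g : Fin (n+1) → (Fin (n+2) → ℝ) → ℝ)
    (hC1 : ∀ j, C1On (g j) (Set.Icc a b))
    (hSM : StrongMono n g (Set.Icc a b)) :
    ∀ p q r : Fin (n+2) → ℝ,
      p ∈ {x | ∀ j, g j x = 0} ∩ frontier (Set.Icc a b) →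
      q ∈ {x | ∀ j, g j x = 0} ∩ frontier (Set.Icc a b) →
      r ∈ {x | ∀ j, g j x = 0} ∩ frontier (Set.Icc a b) →
      p = q ∨ p = r ∨ q = r := by
  rintro p q r ⟨hp, hpB⟩ ⟨hq, hqB⟩ ⟨hr, hrB⟩
  by_contra! hne
  obtain ⟨hpq, hpr, hqr⟩ := hne
  have hsub : frontier (Set.Icc a b) ⊆ Set.Icc a b := isClosed_Icc.frontier_subset
  obtain ⟨D, hD⟩ := hSM.exists_chain (convex_Icc a b) hC1
  have key : ∀ x ∈ frontier (Set.Icc a b), ∀ y ∈ frontier (Set.Icc a b),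
      ∀ z ∈ frontier (Set.Icc a b), (∀ i, D i * x i < D i * y i) →
        ¬ ∀ i, D i * y i < D i * z i :=
    fun x hx y hy z hz hxy hyz =>
      notMem_frontier_Icc_of_between (hsub hx) (hsub hz) hxy hyz hy
  rcases hD p (hsub hpB) q (hsub hqB) hp hq hpq with h1 | h1 <;>
  rcases hD p (hsub hpB) r (hsub hrB) hp hr hpr with h2 | h2 <;>
  rcases hD q (hsub hqB) r (hsub hrB) hq hr hqr with h3 | h3 <;>
  first
  | exact key p hpB q hqB r hrB h1 h3
  | exact key r hrB q hqB p hpB h3 h1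
  | exact key q hqB p hpB r hrB h1 h2
  | exact key r hrB p hpB q hqB h2 h1
  | exact key p hpB r hrB q hqB h2 h3
  | exact key q hqB r hrB p hpB h3 h2
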